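/- The Lie algebra 𝔤₅ = {T(a,b) | a ∈ ℝ ⊕ ℝk, b ∈ ℝi ⊕ ℝj} is a Berger algebra: the endomorphisms R(u, v), for R an algebraic curvature tensor of type 𝔤₅ and u, v ∈ V, span 𝔤₅ over ℝ. -/

import Mathlib

open Quaternion

noncomputable section

/-- `V = ℍ × ℍ`, the pseudo-quaternionic-Hermitian space `ℍ^{1,1}` in an isotropic basis
`p = (1,0)`, `q = (0,1)`. -/
abbrev V : Type := ℍ[ℝ] × ℍ[ℝ]

/-- The neutral-signature metric `η((x,y),(x',y')) = Re(x conj(y') + y conj(x'))`. -/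
def η (u v : V) : ℝ := (u.1 * star v.2 + u.2 * star v.1).re

/-- The endomorphism of `ℍ^{1,1}` with matrix `[[a, b], [0, -conj a]]` in the isotropic
basis `(p, q)`: `T(a,b)(x,y) = (x a + y b, − y conj(a))`. -/
def T (a b : ℍ[ℝ]) : Module.End ℝ V where
  toFun u := (u.1 * a + u.2 * b, -(u.2 * star a))
  map_add' u v := by
    simp only [Prod.fst_add, Prod.snd_add, add_mul, Prod.mk_add_mk, Prod.mk.injEq]
    constructor <;> abel
  map_smul' r u := by
    simp only [Prod.smul_fst, Prod.smul_snd, RingHom.id_apply, Prod.smul_mk,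
      smul_mul_assoc, smul_add, smul_neg]

/-- `R` is an algebraic curvature tensor of type `g`: a bilinear alternating map
`V × V → End_ℝ(V)` with values in `g` satisfying the first Bianchi identity. -/
def IsCurv (g : Set (Module.End ℝ V)) (R : V →ₗ[ℝ] V →ₗ[ℝ] Module.End ℝ V) : Prop :=
  (∀ u v : V, R u v = - R v u) ∧ (∀ u v : V, R u v ∈ g) ∧
  (∀ u v w : V, R u v w + R v w u + R w u v = 0)

/-- The Lie algebra `𝔤₅ = {T(a,b) | a ∈ ℝ ⊕ ℝk, b ∈ ℝi ⊕ ℝj}`. -/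
def g : Set (Module.End ℝ V) :=
  {f | ∃ a b : ℍ[ℝ], a.imI = 0 ∧ a.imJ = 0 ∧ b.re = 0 ∧ b.imK = 0 ∧ f = T a b}

theorem T_add (a b c d : ℍ[ℝ]) : T (a + c) (b + d) = T a b + T c d := by
  refine LinearMap.ext fun u => ?_
  simp only [T, LinearMap.coe_mk, AddHom.coe_mk, LinearMap.add_apply, Prod.mk_add_mk, mul_add,
    star_add, neg_add, Prod.mk.injEq, and_true]
  abel

theorem T_smul (r : ℝ) (a b : ℍ[ℝ]) : T (r • a) (r • b) = r • T a b := by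
  refine LinearMap.ext fun u => ?_
  simp [T]

/-- The diagonal entry of the curvature tensor `g5Curv`. -/
def g5CurvDiag (u v : V) : ℍ[ℝ] :=
  ⟨-(star u.2 * v.2).imJ, 0, 0, (star u.2 * v.2).imI⟩

@[simp]
theorem g5CurvDiag_re (u v : V) : (g5CurvDiag u v).re = -(star u.2 * v.2).imJ :=
  rfl

@[simp]
theorem g5CurvDiag_imI (u v : V) : (g5CurvDiag u v).imI = 0 :=
  rfl

@[simp]
theorem g5CurvDiag_imJ (u v : V) : (g5CurvDiag u v).imJ = 0 :=
  rfl

@[simp]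
theorem g5CurvDiag_imK (u v : V) : (g5CurvDiag u v).imK = (star u.2 * v.2).imI :=
  rfl

/-- The off-diagonal entry of the curvature tensor `g5Curv`. -/
def g5CurvOffDiag (u v : V) : ℍ[ℝ] :=
  ⟨0, (star u.1 * v.2).imK + (star u.2 * v.1).imK,
    (star u.2 * v.1).re - (star u.1 * v.2).re, 0⟩

@[simp]
theorem g5CurvOffDiag_re (u v : V) : (g5CurvOffDiag u v).re = 0 :=
  rfl

@[simp]
theorem g5CurvOffDiag_imI (u v : V) :
    (g5CurvOffDiag u v).imI = (star u.1 * v.2).imK + (star u.2 * v.1).imK :=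
  rfl

@[simp]
theorem g5CurvOffDiag_imJ (u v : V) :
    (g5CurvOffDiag u v).imJ = (star u.2 * v.1).re - (star u.1 * v.2).re :=
  rfl

@[simp]
theorem g5CurvOffDiag_imK (u v : V) : (g5CurvOffDiag u v).imK = 0 :=
  rfl

/-- A curvature tensor of type `g`. Identifying `g` with a Borel subalgebra `⟨h, e⟩` of
`𝔰𝔩(2, ℂ)` acting on `ℂ² ⊗ ℂ²`, it is the symmetric product of `h` and `e`. -/
def g5Curv : V →ₗ[ℝ] V →ₗ[ℝ] Module.End ℝ V :=
  LinearMap.mk₂ ℝ (fun u v => T (g5CurvDiag u v) (g5CurvOffDiag u v))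
    (fun u u' v => by
      rw [← T_add]
      congr 1 <;> ext <;> simp <;> ring)
    (fun r u v => by
      rw [← T_smul]
      congr 1 <;> ext <;> simp <;> ring)
    (fun u v v' => by
      rw [← T_add]
      congr 1 <;> ext <;> simp <;> ring)
    (fun r u v => by
      rw [← T_smul]
      congr 1 <;> ext <;> simp <;> ring)

theorem g5Curv_apply (u v : V) :
    g5Curv u v = T (g5CurvDiag u v) (g5CurvOffDiag u v) := rfl

theorem isCurv_g5Curv : IsCurv g g5Curv := by
  refine ⟨fun u v => ?_, fun u v => ⟨_, _, rfl, rfl, rfl, rfl, rfl⟩, fun u v w => ?_⟩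
  · rw [g5Curv_apply, g5Curv_apply, ← neg_one_smul ℝ (T _ _), ← T_smul]
    congr 1 <;> ext <;> simp <;> ring
  · simp only [g5Curv_apply, T, LinearMap.coe_mk, AddHom.coe_mk]
    ext <;> simp <;> ring

theorem g5Curv_zero_one_apply (x y : ℍ[ℝ]) :
    g5Curv (0, 1) (x, y) = T ⟨-y.imJ, 0, 0, y.imI⟩ ⟨0, x.imK, x.re, 0⟩ := by
  rw [g5Curv_apply]
  congr 1 <;> ext <;> simp

/-- Every element of `g` is a value of `g5Curv`. -/
theorem T_eq_g5Curv {a b : ℍ[ℝ]} (ha₁ : a.imI = 0) (ha₂ : a.imJ = 0)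
    (hb₀ : b.re = 0) (hb₃ : b.imK = 0) :
    T a b = g5Curv (0, 1) (⟨b.imJ, 0, 0, b.imI⟩, ⟨0, a.imK, -a.re, 0⟩) := by
  refine Eq.trans ?_ (g5Curv_zero_one_apply _ _).symm
  congr 1 <;> ext <;> simp [*]

/-- this Lie algebra is a Berger algebra: the endomorphisms `R u v`, for
`R` an algebraic curvature tensor of type the algebra and `u, v ∈ V`, span it over ℝ. -/
theorem g5_is_berger_algebra :
    Submodule.span ℝ {f : Module.End ℝ V |
        ∃ R : V →ₗ[ℝ] V →ₗ[ℝ] Module.End ℝ V, IsCurv g R ∧ ∃ u v : V, f = R u v}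
      = Submodule.span ℝ g := by
  refine le_antisymm (Submodule.span_mono ?_) (Submodule.span_le.2 ?_)
  · rintro _ ⟨R, hR, u, v, rfl⟩
    exact hR.2.1 u v
  · rintro _ ⟨a, b, ha₁, ha₂, hb₀, hb₃, rfl⟩
    exact Submodule.subset_span
      ⟨_, isCurv_g5Curv, _, _, T_eq_g5Curv ha₁ ha₂ hb₀ hb₃⟩

end
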